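/- Let u be the simple Parry word associated with the substitution φ. Define R_s = m−1 if α_0 ≥ 2, and R_s = m + ℓ′ − 1 with ℓ′ = min{ℓ ≥ 1 : α_ℓ ≥ 1} if α_0 = 1. Then φ^{R_s}(0)·0 is a prefix of u, and every factor of u of the form 0t0 with |t|_0 = 0 is a factor of φ^{R_s}(0)·0. -/

import Mathlib

/-- The prefix of length `n` of the infinite word `u`. -/
def pref (u : ℕ → ℕ) (n : ℕ) : List ℕ := (List.range n).map u

/-- `w` is a factor of the infinite word `u`. -/
def IsFactor (u : ℕ → ℕ) (w : List ℕ) : Prop :=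
  ∃ i : ℕ, w = (List.range w.length).map (fun j => u (i + j))

/-- The Parikh vector of `w`, viewed as a word over `{0, …, m-1}`. -/
def parikh (m : ℕ) (w : List ℕ) : Fin m → ℤ := fun ℓ => (w.count (ℓ : ℕ) : ℤ)

/-- The set of relative Parikh vectors of factors of `u` of length `n`. -/
def relParikhSet (m : ℕ) (u : ℕ → ℕ) (n : ℕ) : Set (Fin m → ℤ) :=
  { v | ∃ w : List ℕ, IsFactor u w ∧ w.length = n ∧ v = parikh m w - parikh m (pref u n) }

/-- The extension of a substitution `φ` to finite words. -/
def substW (φ : ℕ → List ℕ) (w : List ℕ) : List ℕ := w.flatMap φ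

/-- The `k`-th iterate of the substitution `φ`, applied to the word `w`. -/
def iterW (φ : ℕ → List ℕ) (k : ℕ) (w : List ℕ) : List ℕ := (substW φ)^[k] w

lemma substW_append (φ : ℕ → List ℕ) (v w : List ℕ) :
    substW φ (v ++ w) = substW φ v ++ substW φ w := by
  simp [substW]

lemma iterW_succ (φ : ℕ → List ℕ) (k : ℕ) (w : List ℕ) :
    iterW φ (k + 1) w = iterW φ k (substW φ w) :=
  Function.iterate_succ_apply _ _ _

lemma iterW_succ' (φ : ℕ → List ℕ) (k : ℕ) (w : List ℕ) :
    iterW φ (k + 1) w = substW φ (iterW φ k w) :=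
  Function.iterate_succ_apply' _ _ _

lemma iterW_add (φ : ℕ → List ℕ) (k l : ℕ) (w : List ℕ) :
    iterW φ (k + l) w = iterW φ k (iterW φ l w) :=
  Function.iterate_add_apply _ _ _ _

lemma iterW_append (φ : ℕ → List ℕ) (k : ℕ) (v w : List ℕ) :
    iterW φ k (v ++ w) = iterW φ k v ++ iterW φ k w := by
  induction k generalizing v w with
  | zero => rfl
  | succ k ih => simp only [iterW_succ, substW_append, ih]

/-- A substitution whose image of `0` starts with `0` preserves words starting with `0`. -/
lemma singleton_zero_isPrefix_iterW {φ : ℕ → List ℕ} (h0 : [0] <+: φ 0) {w : List ℕ}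
    (hw : [0] <+: w) (k : ℕ) : [0] <+: iterW φ k w := by
  induction k generalizing w with
  | zero => exact hw
  | succ k ih =>
    rw [iterW_succ]
    obtain ⟨v, rfl⟩ := hw
    refine ih ?_
    rw [substW_append]
    exact (by simpa [substW] using h0 : [0] <+: substW φ [0]).trans (List.prefix_append _ _)

lemma isPrefix_pref {u : ℕ → ℕ} {w : List ℕ} {n : ℕ} (h : w <+: pref u n) :
    w = pref u w.length := by
  have hle : w.length ≤ n := by simpa [pref] using h.length_le
  rw [List.prefix_iff_eq_take] at h
  conv_lhs => rw [h]
  simp [pref, ← List.map_take, List.take_range, hle]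

lemma IsFactor.exists_isInfix_pref {u : ℕ → ℕ} {w : List ℕ} (h : IsFactor u w) :
    ∃ N, ∀ n, N ≤ n → w <:+: pref u n := by
  obtain ⟨i, hi⟩ := h
  refine ⟨i + w.length, fun n hn => ?_⟩
  obtain ⟨c, rfl⟩ := Nat.exists_eq_add_of_le hn
  refine ⟨pref u i, (List.range c).map fun j => u (i + w.length + j), ?_⟩
  conv_lhs => rw [hi]
  simp [pref, List.range_add, Function.comp_def]

/-- The letter preceding every occurrence of a non-zero letter in a simple Parry word. -/
def predLetter (α : ℕ → ℕ) : ℕ → ℕ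
  | 0 => 0
  | j + 1 => if 1 ≤ α j then 0 else predLetter α j + 1

lemma predLetter_le (α : ℕ → ℕ) (hα0 : 1 ≤ α 0) (j : ℕ) : predLetter α j ≤ j - 1 := by
  induction j with
  | zero => simp [predLetter]
  | succ j ih =>
    rw [predLetter]
    split_ifs with h
    · simp
    · have : j ≠ 0 := by rintro rfl; exact h hα0
      omega

/-- `a` may precede `b` in a simple Parry word. -/
def MayPrecede (α : ℕ → ℕ) (a b : ℕ) : Prop := b ≠ 0 → a = predLetter α b

lemma isPrefix_of_isChain_flip {α : ℕ → ℕ} {s : List ℕ} (hs : 0 ∉ s) {y : List ℕ}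
    (hhead : (s ++ [0]).head? = y.head?)
    (hsc : (s ++ [0]).IsChain (flip (MayPrecede α))) (hyc : y.IsChain (flip (MayPrecede α)))
    (hlast : y.getLast? = some 0) : s ++ [0] <+: y := by
  induction s generalizing y with
  | nil =>
    cases y with
    | nil => simp at hlast
    | cons j x => simp at hhead; subst hhead; simp
  | cons j s ih =>
    cases y with
    | nil => simp at hlast
    | cons j' x =>
      obtain rfl : j = j' := by simpa using hhead
      have hj : j ≠ 0 := fun h => hs (by simp [h])
      rw [List.cons_append, List.isChain_cons] at hsc
      rw [List.isChain_cons] at hyc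
      rw [List.cons_append, List.prefix_cons_inj]
      have hx : x ≠ [] := by
        rintro rfl
        exact hj (by simpa using hlast)
      have hs' : s ++ [0] ≠ [] := by simp
      refine ih (fun h => hs (by simp [h])) ?_ hsc.2 hyc.2 ?_
      · rw [List.head?_eq_some_head hx, List.head?_eq_some_head hs']
        rw [hsc.1 _ (List.head?_eq_some_head hs') hj, hyc.1 _ (List.head?_eq_some_head hx) hj]
      · rwa [List.getLast?_cons_of_ne_nil hx] at hlast

/-- A zero-free run is determined by its last letter. -/
lemma isSuffix_of_isChain {α : ℕ → ℕ} {t y : List ℕ} (ht : 0 ∉ t)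
    (hlast : (0 :: t).getLast? = y.getLast?) (htc : (0 :: t).IsChain (MayPrecede α))
    (hyc : y.IsChain (MayPrecede α)) (hhead : y.head? = some 0) : 0 :: t <:+ y := by
  suffices h : t.reverse ++ [0] <+: y.reverse by simpa using h.reverse
  refine isPrefix_of_isChain_flip (α := α) (by simpa using ht) ?_ ?_ ?_ ?_
  · rw [← List.reverse_cons, List.head?_reverse, List.head?_reverse, hlast]
  · rw [← List.reverse_cons, List.isChain_reverse]; exact htc
  · rw [List.isChain_reverse]; exact hyc
  · rw [List.getLast?_reverse, hhead]

section SimpleParry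

variable {m : ℕ} {α : ℕ → ℕ} {φ : ℕ → List ℕ}

lemma getLast?_image (hαlast : 1 ≤ α (m - 1))
    (hφ : ∀ ℓ, ℓ + 1 < m → φ ℓ = List.replicate (α ℓ) 0 ++ [ℓ + 1])
    (hφlast : φ (m - 1) = List.replicate (α (m - 1)) 0) {ℓ : ℕ} (hℓ : ℓ < m) :
    (φ ℓ).getLast? = some ((ℓ + 1) % m) := by
  rcases Nat.lt_or_ge (ℓ + 1) m with h | h
  · rw [hφ ℓ h, Nat.mod_eq_of_lt h]; simp
  · obtain rfl : ℓ = m - 1 := by omega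
    rw [hφlast, show m - 1 + 1 = m by omega, Nat.mod_self, List.getLast?_replicate]
    simp; omega

lemma singleton_zero_isPrefix_image
    (hφ : ∀ ℓ, ℓ + 1 < m → φ ℓ = List.replicate (α ℓ) 0 ++ [ℓ + 1])
    (hφlast : φ (m - 1) = List.replicate (α (m - 1)) 0) {ℓ : ℕ} (hℓ : ℓ < m)
    (hα : 1 ≤ α ℓ) : [0] <+: φ ℓ := by
  obtain ⟨c, hc⟩ := Nat.exists_eq_add_of_le' hα
  rcases Nat.lt_or_ge (ℓ + 1) m with h | h
  · rw [hφ ℓ h, hc, List.replicate_succ]; simp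
  · obtain rfl : ℓ = m - 1 := by omega
    rw [hφlast, hc, List.replicate_succ]; simp

lemma getLast?_iterW (hm : 0 < m) (hαlast : 1 ≤ α (m - 1))
    (hφ : ∀ ℓ, ℓ + 1 < m → φ ℓ = List.replicate (α ℓ) 0 ++ [ℓ + 1])
    (hφlast : φ (m - 1) = List.replicate (α (m - 1)) 0) (k : ℕ) :
    (iterW φ k [0]).getLast? = some (k % m) := by
  induction k with
  | zero => simp [iterW]
  | succ k ih =>
    obtain ⟨w, hw⟩ := List.getLast?_eq_some_iff.1 ih
    rw [iterW_succ', hw, substW_append, List.getLast?_append]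
    simp [substW, getLast?_image hαlast hφ hφlast (Nat.mod_lt k hm)]

lemma isChain_image (hφ : ∀ ℓ, ℓ + 1 < m → φ ℓ = List.replicate (α ℓ) 0 ++ [ℓ + 1])
    (hφlast : φ (m - 1) = List.replicate (α (m - 1)) 0) {ℓ : ℕ} (hℓ : ℓ < m) :
    (φ ℓ).IsChain (MayPrecede α) := by
  have hrep : ∀ n, (List.replicate n 0).IsChain (MayPrecede α) := fun n =>
    List.isChain_replicate_of_rel n fun h => absurd rfl h
  rcases Nat.lt_or_ge (ℓ + 1) m with h | h
  · rw [hφ ℓ h, List.isChain_append]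
    refine ⟨hrep _, List.isChain_singleton _, ?_⟩
    intro x hx y hy _
    simp at hy
    subst hy
    rw [List.getLast?_replicate] at hx
    split_ifs at hx with h0
    · simp at hx
    · simp at hx
      rw [predLetter, if_pos (by omega), hx]
  · obtain rfl : ℓ = m - 1 := by omega
    rw [hφlast]; exact hrep _

lemma isChain_substW (hα0 : 1 ≤ α 0) (hαlast : 1 ≤ α (m - 1))
    (hφ : ∀ ℓ, ℓ + 1 < m → φ ℓ = List.replicate (α ℓ) 0 ++ [ℓ + 1])
    (hφlast : φ (m - 1) = List.replicate (α (m - 1)) 0) {w : List ℕ} (hwm : ∀ a ∈ w, a < m)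
    (hw : w.IsChain (MayPrecede α)) : (substW φ w).IsChain (MayPrecede α) := by
  rw [substW, List.flatMap_def, List.isChain_flatten]
  · refine ⟨?_, ?_⟩
    · intro l hl
      obtain ⟨a, ha, rfl⟩ := List.mem_map.1 hl
      exact isChain_image hφ hφlast (hwm a ha)
    · rw [List.isChain_map]
      refine List.IsChain.imp_of_mem_imp ?_ hw
      intro a b ha hb hab x hx y hy hy0
      have hbm := hwm b hb
      by_cases hαb : 1 ≤ α b
      · obtain ⟨v, hv⟩ := singleton_zero_isPrefix_image hφ hφlast hbm hαb
        rw [← hv] at hy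
        simp at hy
        exact absurd hy.symm hy0
      · have hb1 : b + 1 < m := by
          by_contra h
          obtain rfl : b = m - 1 := by omega
          exact hαb hαlast
        have hb0 : b ≠ 0 := by rintro rfl; exact hαb hα0
        have hab' := hab hb0
        have hple := predLetter_le α hα0 b
        rw [hφ b hb1, show α b = 0 by omega] at hy
        simp at hy
        rw [getLast?_image hαlast hφ hφlast (hwm a ha), Nat.mod_eq_of_lt (by omega)] at hx
        simp at hx
        rw [← hx, ← hy, predLetter, if_neg hαb, hab']
  · intro h
    obtain ⟨a, ha, hnil⟩ := List.mem_map.1 h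
    have := getLast?_image hαlast hφ hφlast (hwm a ha)
    simp [hnil] at this

/-- Once the images of the letter following the initial `0` start with `0`, the iterates
extended by `0` are again prefixes of the next iterate. -/
lemma exists_shift_iterW_append_zero_isPrefix (hm : 2 ≤ m) (hα0 : 1 ≤ α 0)
    (hαlast : 1 ≤ α (m - 1))
    (hφ : ∀ ℓ, ℓ + 1 < m → φ ℓ = List.replicate (α ℓ) 0 ++ [ℓ + 1])
    (hφlast : φ (m - 1) = List.replicate (α (m - 1)) 0) (R : ℕ)
    (hR : R = if 2 ≤ α 0 then m - 1 else m + sInf {ℓ : ℕ | 1 ≤ ℓ ∧ 1 ≤ α ℓ} - 1) :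
    ∃ s, R = s + (m - 1) ∧ ∀ k, s ≤ k → iterW φ k [0] ++ [0] <+: iterW φ (k + 1) [0] := by
  have h0 : [0] <+: φ 0 := singleton_zero_isPrefix_image hφ hφlast (by omega) hα0
  have hsub : substW φ [0] = [0] ++ (List.replicate (α 0 - 1) 0 ++ [1]) := by
    obtain ⟨c, hc⟩ := Nat.exists_eq_add_of_le' hα0
    simp [substW, hφ 0 (by omega), hc, List.replicate_succ]
  by_cases h2 : 2 ≤ α 0
  · rw [if_pos h2] at hR
    refine ⟨0, by omega, fun k _ => ?_⟩
    rw [iterW_succ, hsub, iterW_append, List.prefix_append_right_inj]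
    refine singleton_zero_isPrefix_iterW h0 ?_ k
    obtain ⟨c, hc⟩ := Nat.exists_eq_add_of_le' h2
    simp [hc, List.replicate_succ]
  · rw [if_neg h2] at hR
    set S : Set ℕ := {ℓ : ℕ | 1 ≤ ℓ ∧ 1 ≤ α ℓ} with hS
    have hmem : m - 1 ∈ S := ⟨by omega, hαlast⟩
    have hℓ : sInf S ∈ S := Nat.sInf_mem ⟨_, hmem⟩
    have hℓm : sInf S ≤ m - 1 := Nat.sInf_le hmem
    have hone : ∀ j, j + 1 ≤ sInf S → iterW φ j [1] = [j + 1] := by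
      intro j
      induction j with
      | zero => intro _; rfl
      | succ j ih =>
        intro hj
        have hα : α (j + 1) = 0 := by
          by_contra h
          exact Nat.notMem_of_lt_sInf (show j + 1 < sInf S by omega) ⟨by omega, by omega⟩
        rw [iterW_succ', ih (by omega)]
        simp [substW, hφ (j + 1) (by omega), hα]
    refine ⟨sInf S, by omega, fun k hk => ?_⟩
    rw [iterW_succ, hsub, iterW_append, List.prefix_append_right_inj,
      show α 0 - 1 = 0 by omega]
    obtain ⟨c, rfl⟩ := Nat.exists_eq_add_of_le' hk
    obtain ⟨d, hd⟩ := Nat.exists_eq_add_of_le' hℓ.1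
    rw [iterW_add]
    refine singleton_zero_isPrefix_iterW h0 ?_ c
    rw [hd, iterW_succ', List.replicate_zero, List.nil_append, hone d (by omega), ← hd]
    simpa [substW] using singleton_zero_isPrefix_image hφ hφlast (by omega) hℓ.2

end SimpleParry

theorem stmt7
    (m : ℕ) (hm : 2 ≤ m) (α : ℕ → ℕ) (hα0 : 1 ≤ α 0)
    (hαle : ∀ ℓ, ℓ < m → α ℓ ≤ α 0) (hαlast : 1 ≤ α (m - 1))
    (φ : ℕ → List ℕ)
    (hφ : ∀ ℓ, ℓ + 1 < m → φ ℓ = List.replicate (α ℓ) 0 ++ [ℓ + 1])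
    (hφlast : φ (m - 1) = List.replicate (α (m - 1)) 0)
    (u : ℕ → ℕ) (hu : ∀ i, u i < m)
    (hufix : ∀ k : ℕ, iterW φ k [0] = pref u (iterW φ k [0]).length)
    (R : ℕ)
    (hR : R = if 2 ≤ α 0 then m - 1 else m + sInf {ℓ : ℕ | 1 ≤ ℓ ∧ 1 ≤ α ℓ} - 1) :
    (iterW φ R [0] ++ [0]) = pref u (iterW φ R [0] ++ [0]).length ∧
    (∀ t : List ℕ, t.count 0 = 0 → IsFactor u ([0] ++ t ++ [0]) →
      ([0] ++ t ++ [0]) <:+: (iterW φ R [0] ++ [0])) := by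
  obtain ⟨s, hRs, hstep⟩ :=
    exists_shift_iterW_append_zero_isPrefix hm hα0 hαlast hφ hφlast R hR
  have hlt : ∀ k n, s ≤ k → k < n → iterW φ k [0] ++ [0] <+: iterW φ n [0] := by
    intro k n hk hkn
    induction n, hkn using Nat.le_induction with
    | base => exact hstep k hk
    | succ n hn ih => exact ih.trans ((List.prefix_append _ _).trans (hstep n (by omega)))
  have hlen : ∀ d, d ≤ (iterW φ (s + d) [0]).length := by
    intro d
    induction d with
    | zero => omega
    | succ d ih =>
      have := (hstep (s + d) (by omega)).length_le
      simp only [List.length_append, List.length_singleton] at this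
      rw [← Nat.add_assoc]
      omega
  have hchain : ∀ k, (iterW φ k [0]).IsChain (MayPrecede α) := by
    intro k
    induction k with
    | zero => exact List.isChain_singleton _
    | succ k ih =>
      rw [iterW_succ']
      refine isChain_substW hα0 hαlast hφ hφlast (fun a ha => ?_) ih
      rw [hufix k] at ha
      obtain ⟨i, -, rfl⟩ := List.mem_map.1 ha
      exact hu i
  refine ⟨?_, fun t ht hfac => ?_⟩
  · have h := hstep R (by omega)
    rw [hufix (R + 1)] at h
    exact isPrefix_pref h
  · have ht0 : 0 ∉ t := List.count_eq_zero.1 ht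
    obtain ⟨N, hN⟩ := hfac.exists_isInfix_pref
    have hinf := hN _ (hlen N)
    rw [← hufix] at hinf
    have htc : (0 :: t).IsChain (MayPrecede α) := by
      obtain ⟨x, y, hxy⟩ := hinf
      have h := hchain (s + N)
      rw [← hxy] at h
      exact h.left_of_append.right_of_append.left_of_append
    obtain ⟨j, hj⟩ : ∃ j, (0 :: t).getLast? = some j := ⟨_, List.getLast?_eq_some_getLast (by simp)⟩
    have hjm : j < m := by
      have hmem : j ∈ iterW φ (s + N) [0] :=
        hinf.subset (List.mem_append_left _ (List.mem_of_getLast? hj))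
      rw [hufix] at hmem
      obtain ⟨i, -, rfl⟩ := List.mem_map.1 hmem
      exact hu i
    obtain ⟨k, hsk, hkR, hkj⟩ : ∃ k, s ≤ k ∧ k ≤ R ∧ k % m = j := by
      have hdm := Nat.div_add_mod s m
      have hsm := Nat.mod_lt s (show 0 < m by omega)
      rcases Nat.lt_or_ge j (s % m) with h | h
      · refine ⟨j + m * (s / m + 1), ?_, ?_, ?_⟩
        · rw [Nat.mul_add]; omega
        · rw [Nat.mul_add]; omega
        · rw [Nat.add_mul_mod_self_left, Nat.mod_eq_of_lt hjm]
      · refine ⟨j + m * (s / m), by omega, by omega, ?_⟩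
        rw [Nat.add_mul_mod_self_left, Nat.mod_eq_of_lt hjm]
    have h0 : [0] <+: φ 0 := singleton_zero_isPrefix_image hφ hφlast (by omega) hα0
    obtain ⟨v, hv⟩ := singleton_zero_isPrefix_iterW h0 (List.prefix_refl [0]) k
    have hsuf : 0 :: t <:+ iterW φ k [0] :=
      isSuffix_of_isChain ht0
        (by rw [hj, getLast?_iterW (by omega) hαlast hφ hφlast, hkj]) htc (hchain k)
        (by rw [← hv]; rfl)
    have hsuf' : [0] ++ t ++ [0] <:+ iterW φ k [0] ++ [0] := by
      obtain ⟨x, hx⟩ := hsuf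
      exact ⟨x, by rw [← hx]; simp⟩
    refine hsuf'.isInfix.trans ?_
    rcases Nat.lt_or_ge k R with h | h
    · exact ((hlt k R hsk h).trans (List.prefix_append _ _)).isInfix
    · rw [Nat.le_antisymm hkR h]
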